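/- arXiv:2603.17107 — 6 statements merged into one kernel-verified Lean document; each statement's English description precedes it below -/
import Mathlib

section
/- Let n ≥ 1 and let a : Fin n → ℤ with a i > 0 for all i. Suppose that for every sign vector σ : Fin n → ℤ with σ i ∈ {-1, 1} for all i one has ∑ i, a i * σ i ≠ 0. Then every x : Fin n → ℝ with |x i| ≤ 1 for all i and ∑ i, (a i : ℝ) * x i = 0 satisfies ∑ i, |x i| ≤ n - 1 / (↑(Finset.univ.sup' (by simp) a) : ℝ), i.e. the ℓ1-norm of x is at most n minus the reciprocal of the maximum entry of a. -/
theorem stmt_0 (n : ℕ) (hn : 1 ≤ n) (a : Fin n → ℤ) (ha : ∀ i, 0 < a i)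
    (hpart : ∀ σ : Fin n → ℤ, (∀ i, σ i = -1 ∨ σ i = 1) → ∑ i, a i * σ i ≠ 0)
    (x : Fin n → ℝ) (hx : ∀ i, |x i| ≤ 1) (horth : ∑ i, (a i : ℝ) * x i = 0) :
    ∑ i, |x i| ≤
      (n : ℝ) - 1 / ((Finset.univ.sup' (Finset.univ_nonempty_iff.mpr ⟨⟨0, hn⟩⟩) a : ℤ) : ℝ) := by
  have hM : ∀ i, a i ≤ Finset.univ.sup' (Finset.univ_nonempty_iff.mpr ⟨⟨0, hn⟩⟩) a :=
    fun i => Finset.le_sup' a (Finset.mem_univ i)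
  generalize Finset.univ.sup' (Finset.univ_nonempty_iff.mpr ⟨⟨0, hn⟩⟩) a = M at hM ⊢
  have hMpos : (0 : ℝ) < (M : ℝ) := by
    exact_mod_cast lt_of_lt_of_le (ha ⟨0, hn⟩) (hM ⟨0, hn⟩)
  obtain ⟨σ, hσ, hσx⟩ : ∃ σ : Fin n → ℤ, (∀ i, σ i = -1 ∨ σ i = 1) ∧
      ∀ i, |(σ i : ℝ) - x i| = 1 - |x i| := by
    refine ⟨fun i => if 0 ≤ x i then 1 else -1, fun i => ?_, fun i => ?_⟩
    · by_cases h : 0 ≤ x i <;> simp [h]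
    · have h1 := abs_le.1 (hx i)
      by_cases h : 0 ≤ x i
      · simp only [h, if_true, Int.cast_one]
        rw [abs_of_nonneg h, abs_of_nonneg (by linarith)]
      · simp only [h, if_false, Int.cast_neg, Int.cast_one]
        rw [abs_of_neg (not_le.1 h), abs_of_nonpos (by linarith)]
        ring
  have h1 : (1 : ℝ) ≤ |∑ i, (a i : ℝ) * (σ i : ℝ)| := by
    exact_mod_cast Int.one_le_abs (hpart σ hσ)
  have h2 : ∑ i, (a i : ℝ) * (σ i : ℝ) = ∑ i, (a i : ℝ) * ((σ i : ℝ) - x i) := by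
    simp only [mul_sub, Finset.sum_sub_distrib, horth, sub_zero]
  have h3 : |∑ i, (a i : ℝ) * ((σ i : ℝ) - x i)| ≤ ∑ i, (M : ℝ) * (1 - |x i|) := by
    refine (Finset.abs_sum_le_sum_abs _ _).trans (Finset.sum_le_sum fun i _ => ?_)
    have hp : (0 : ℝ) < a i := by exact_mod_cast ha i
    have hm : (a i : ℝ) ≤ M := by exact_mod_cast hM i
    rw [abs_mul, hσx, abs_of_pos hp]
    exact mul_le_mul_of_nonneg_right hm (by linarith [hx i])
  have h4 : ∑ i, (M : ℝ) * (1 - |x i|) = ((n : ℝ) - ∑ i, |x i|) * M := by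
    rw [← Finset.mul_sum, Finset.sum_sub_distrib]
    simp [mul_comm]
  have h5 : 1 / (M : ℝ) ≤ (n : ℝ) - ∑ i, |x i| := by
    rw [div_le_iff₀ hMpos]
    rw [h2] at h1
    linarith
  linarith
end

section
/- Let m n be natural numbers, A : Matrix (Fin m) (Fin n) ℝ and b : Fin m → ℝ. Then the set of x : Fin n → ℝ such that (i) A.mulVec x ≤ b componentwise, (ii) 0 ≤ x i ≤ 1 for all i, and (iii) y = 0 maximizes ∑ i, y i over {y : Fin n → ℝ | ∀ i, 2 * y i ≤ x i ∧ y i ≤ 1 - x i}, is exactly the set {x : Fin n → ℝ | (∀ i, x i = 0 ∨ x i = 1) ∧ A.mulVec x ≤ b}. -/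
theorem stmt_3 (m n : ℕ) (A : Matrix (Fin m) (Fin n) ℝ) (b : Fin m → ℝ) :
    {x : Fin n → ℝ | A.mulVec x ≤ b ∧ (∀ i, 0 ≤ x i ∧ x i ≤ 1) ∧
        (0 : Fin n → ℝ) ∈ {y : Fin n → ℝ | ∀ i, 2 * y i ≤ x i ∧ y i ≤ 1 - x i} ∧
        ∀ y ∈ {y : Fin n → ℝ | ∀ i, 2 * y i ≤ x i ∧ y i ≤ 1 - x i},
          ∑ i, y i ≤ ∑ i, (0 : Fin n → ℝ) i} =
      {x : Fin n → ℝ | (∀ i, x i = 0 ∨ x i = 1) ∧ A.mulVec x ≤ b} := by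
  ext x
  simp only [Set.mem_setOf_eq, Pi.zero_apply, Finset.sum_const_zero]
  constructor
  · rintro ⟨hA, hx, -, hopt⟩
    refine ⟨fun i => ?_, hA⟩
    have hle := hopt (fun i => min (x i / 2) (1 - x i)) (fun j => by
      have h1 := min_le_left (x j / 2) (1 - x j)
      have h2 := min_le_right (x j / 2) (1 - x j)
      exact ⟨by linarith, h2⟩)
    have hnn : ∀ j ∈ Finset.univ, 0 ≤ min (x j / 2) (1 - x j) := fun j _ =>
      le_min (by linarith [(hx j).1]) (by linarith [(hx j).2])
    have h0 := (Finset.sum_eq_zero_iff_of_nonneg hnn).1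
      (le_antisymm hle (Finset.sum_nonneg hnn)) i (Finset.mem_univ i)
    rcases min_choice (x i / 2) (1 - x i) with h | h
    · left; linarith
    · right; linarith
  · rintro ⟨hx, hA⟩
    refine ⟨hA, fun i => ?_, fun i => ?_, fun y hy => Finset.sum_nonpos fun i _ => ?_⟩
    · rcases hx i with h | h <;> rw [h] <;> norm_num
    · rcases hx i with h | h <;> rw [h] <;> norm_num
    · have := hy i
      rcases hx i with h | h <;> rw [h] at this <;> linarith [this.1, this.2]
end

section
/- Let m n be natural numbers with n ≥ 1, A : Matrix (Fin m) (Fin n) ℤ, b : Fin m → ℤ, c : Fin n → ℤ, and suppose A.mulVec 0 ≤ b componentwise. Set M := n * (Finset.univ.sup' (by simp) (fun i => |c i|)) + 1. Let F' := {(x, z) : (Fin n → ℤ) × ℤ | (∀ i, x i = 0 ∨ x i = 1) ∧ (z = 0 ∨ z = 1) ∧ A.mulVec x ≤ b ∧ ∑ i, c i * x i ≤ -1 + M * (1 - z)}. Then (0, 0) ∈ F', and the minimum of -z over F' equals -1 if there exists a binary x with A.mulVec x ≤ b and ∑ i, c i * x i ≤ -1, and equals 0 otherwise. -/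
theorem stmt_7 (m n : ℕ) (hn : 1 ≤ n) (A : Matrix (Fin m) (Fin n) ℤ) (b : Fin m → ℤ)
    (c : Fin n → ℤ) (hb : A.mulVec 0 ≤ b)
    (M : ℤ)
    (hM : M = n * Finset.univ.sup' (Finset.univ_nonempty_iff.mpr ⟨⟨0, hn⟩⟩) (fun i => |c i|) + 1)
    (F' : Set ((Fin n → ℤ) × ℤ))
    (hF' : F' = {p | (∀ i, p.1 i = 0 ∨ p.1 i = 1) ∧ (p.2 = 0 ∨ p.2 = 1) ∧
        A.mulVec p.1 ≤ b ∧ ∑ i, c i * p.1 i ≤ -1 + M * (1 - p.2)}) :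
    ((0, 0) ∈ F') ∧
      ((∃ x : Fin n → ℤ, (∀ i, x i = 0 ∨ x i = 1) ∧ A.mulVec x ≤ b ∧ ∑ i, c i * x i ≤ -1) →
        IsLeast ((fun p : (Fin n → ℤ) × ℤ => -p.2) '' F') (-1)) ∧
      ((¬ ∃ x : Fin n → ℤ, (∀ i, x i = 0 ∨ x i = 1) ∧ A.mulVec x ≤ b ∧ ∑ i, c i * x i ≤ -1) →
        IsLeast ((fun p : (Fin n → ℤ) × ℤ => -p.2) '' F') 0) := by
  have hM1 : 1 ≤ M := by
    have h : (0:ℤ) ≤ Finset.univ.sup' (Finset.univ_nonempty_iff.mpr ⟨⟨0, hn⟩⟩) (fun i => |c i|) :=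
      le_trans (abs_nonneg (c ⟨0, hn⟩))
        (Finset.le_sup' (fun i => |c i|) (Finset.mem_univ (⟨0, hn⟩ : Fin n)))
    have h2 := mul_nonneg (Int.natCast_nonneg n) h
    rw [hM]
    linarith
  have h0 : ((0, 0) : (Fin n → ℤ) × ℤ) ∈ F' := by
    rw [hF']
    refine ⟨fun i => Or.inl rfl, Or.inl rfl, hb, ?_⟩
    simp
    linarith
  refine ⟨h0, ?_, ?_⟩
  · rintro ⟨x, hx, hA, hc⟩
    refine ⟨⟨(x, 1), ?_, rfl⟩, ?_⟩
    · rw [hF']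
      exact ⟨hx, Or.inr rfl, hA, by simpa using hc⟩
    · rintro _ ⟨p, hp, rfl⟩
      rw [hF'] at hp
      obtain ⟨-, h | h, -⟩ := hp <;> simp [h]
  · intro hne
    refine ⟨⟨(0, 0), h0, by simp⟩, ?_⟩
    rintro _ ⟨p, hp, rfl⟩
    rw [hF'] at hp
    obtain ⟨hx, h | h, hA, hc⟩ := hp
    · simp [h]
    · exact absurd ⟨p.1, hx, hA, by simpa [h] using hc⟩ hne
end

section
/- Let m n be natural numbers with n ≥ 1, A : Matrix (Fin m) (Fin n) ℝ, b : Fin m → ℝ with A.mulVec 0 ≤ b componentwise, c : Fin n → ℝ, and η : ℝ with η > 2 * ∑ i, |c i|. Then x = 0 is the unique minimizer of the function x ↦ ∑ i, c i * x i + (η / 2) * (Finset.univ.sup' (by simp [Finset.univ_nonempty_iff]) (fun i => |x i|)) over the set {x : Fin n → ℝ | A.mulVec x ≤ b ∧ ∀ i, 0 ≤ x i ∧ x i ≤ 1/2}. -/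
theorem stmt_10 (m n : ℕ) (hn : 1 ≤ n) (A : Matrix (Fin m) (Fin n) ℝ) (b : Fin m → ℝ)
    (hb : A.mulVec 0 ≤ b) (c : Fin n → ℝ) (η : ℝ) (hη : 2 * ∑ i, |c i| < η)
    (f : (Fin n → ℝ) → ℝ)
    (hf : f = fun x => ∑ i, c i * x i +
        (η / 2) * Finset.univ.sup' (Finset.univ_nonempty_iff.mpr ⟨⟨0, hn⟩⟩) (fun i => |x i|)) :
    (0 : Fin n → ℝ) ∈ {x : Fin n → ℝ | A.mulVec x ≤ b ∧ ∀ i, 0 ≤ x i ∧ x i ≤ 1 / 2} ∧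
      ∀ x ∈ {x : Fin n → ℝ | A.mulVec x ≤ b ∧ ∀ i, 0 ≤ x i ∧ x i ≤ 1 / 2},
        x ≠ 0 → f 0 < f x := by
  refine ⟨⟨hb, fun i => by simp⟩, ?_⟩
  rintro x - hx
  have h0 : f 0 = 0 := by
    rw [hf]
    simp
  rw [h0, hf]
  show 0 < ∑ i, c i * x i +
        (η / 2) * Finset.univ.sup' (Finset.univ_nonempty_iff.mpr ⟨⟨0, hn⟩⟩) (fun i => |x i|)
  set M := Finset.univ.sup' (Finset.univ_nonempty_iff.mpr ⟨⟨0, hn⟩⟩) (fun i => |x i|) with hM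
  have hle : ∀ i, |x i| ≤ M := fun i =>
    Finset.le_sup' (fun i => |x i|) (Finset.mem_univ i)
  obtain ⟨j, hj⟩ := Function.ne_iff.mp hx
  have hMpos : 0 < M := lt_of_lt_of_le (abs_pos.mpr hj) (hle j)
  have h1 : -((∑ i, |c i|) * M) ≤ ∑ i, c i * x i := by
    rw [Finset.sum_mul, ← Finset.sum_neg_distrib]
    refine Finset.sum_le_sum fun i _ => ?_
    have h2 := neg_abs_le (c i * x i)
    rw [abs_mul] at h2
    have h3 := mul_le_mul_of_nonneg_left (hle i) (abs_nonneg (c i))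
    linarith
  have h4 : 0 < (η / 2 - ∑ i, |c i|) * M := mul_pos (by linarith) hMpos
  linarith
end

section
/- Let n be a natural number, c : Fin n → ℝ, η : ℝ with η > 2 * ∑ i, |c i|, and x λ ν u v : Fin n → ℝ satisfying, for every i: x i ∈ {0, 1}, 2 * λ i + ν i = 2, 0 ≤ u i, u i ≤ λ i, 0 ≤ v i, v i ≤ ν i, u i ≤ x i, v i ≤ x i, u i ≥ λ i + (x i - 1), and v i ≥ ν i + (x i - 1). If x ≠ 0, then ∑ i, c i * x i + η * ∑ i, (u i + ν i - v i) > 0. Consequently, x = 0 (together with λ = 1, ν = u = v = 0) is the unique optimal choice of x for minimizing ∑ i, c i * x i + η * ∑ i, (u i + ν i - v i) over all feasible tuples. -/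
theorem stmt_13 (n : ℕ) (c : Fin n → ℝ) (η : ℝ) (hη : 2 * ∑ i, |c i| < η)
    (x lam nu u v : Fin n → ℝ)
    (hx : ∀ i, x i = 0 ∨ x i = 1)
    (h1 : ∀ i, 2 * lam i + nu i = 2)
    (h2 : ∀ i, 0 ≤ u i) (h3 : ∀ i, u i ≤ lam i)
    (h4 : ∀ i, 0 ≤ v i) (h5 : ∀ i, v i ≤ nu i)
    (h6 : ∀ i, u i ≤ x i) (h7 : ∀ i, v i ≤ x i)
    (h8 : ∀ i, u i ≥ lam i + (x i - 1)) (h9 : ∀ i, v i ≥ nu i + (x i - 1)) :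
    (x ≠ 0 → 0 < ∑ i, c i * x i + η * ∑ i, (u i + nu i - v i)) ∧
      (x = 0 ∧ lam = 1 ∧ nu = 0 ∧ u = 0 ∧ v = 0 →
        ∑ i, c i * x i + η * ∑ i, (u i + nu i - v i) = 0) := by
  constructor
  · intro hne
    obtain ⟨j, hj⟩ : ∃ j, x j ≠ 0 := by
      by_contra hcon
      push Not at hcon
      exact hne (funext hcon)
    have hj1 : x j = 1 := (hx j).resolve_left hj
    have hnn : ∀ i ∈ Finset.univ, 0 ≤ u i + nu i - v i := fun i _ => by
      linarith [h2 i, h5 i]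
    have hs : u j + nu j - v j ≤ ∑ i, (u i + nu i - v i) :=
      Finset.single_le_sum hnn (Finset.mem_univ j)
    have hhalf : 1 / 2 ≤ u j + nu j - v j := by
      linarith [h1 j, h3 j, h5 j, h7 j, h8 j, h9 j]
    have hc : -∑ i, |c i| ≤ ∑ i, c i * x i := by
      rw [← Finset.sum_neg_distrib]
      refine Finset.sum_le_sum fun i _ => ?_
      rcases hx i with h | h <;> rw [h]
      · simp
      · simpa using neg_abs_le (c i)
    have hc0 : 0 ≤ ∑ i, |c i| := Finset.sum_nonneg fun i _ => abs_nonneg _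
    have hm : η * (1 / 2) ≤ η * ∑ i, (u i + nu i - v i) :=
      mul_le_mul_of_nonneg_left (hhalf.trans hs) (by linarith)
    linarith
  · rintro ⟨rfl, rfl, rfl, rfl, rfl⟩
    simp
end

section
/- Let n ≥ 1, K θ ψ : ℝ with K < n, θ + 2*ψ = 2, ψ ≥ 0, λ ν : Fin n → ℝ with λ i ≥ 0, ν i ≥ 0, and λ i + ν i = θ for every i, and x : Fin n → ℝ with |x i| ≤ 1 for all i. If ∑ i, (λ i - ν i) * x i - K * θ = 2 * (n - K), then θ = 2 and ψ = 0. -/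
theorem stmt_17 (n : ℕ) (hn : 1 ≤ n) (K θ ψ : ℝ) (hK : K < n) (hθψ : θ + 2 * ψ = 2)
    (hψ : 0 ≤ ψ) (lam nu : Fin n → ℝ)
    (hlam : ∀ i, 0 ≤ lam i) (hnu : ∀ i, 0 ≤ nu i) (hsum : ∀ i, lam i + nu i = θ)
    (x : Fin n → ℝ) (hx : ∀ i, |x i| ≤ 1)
    (hopt : ∑ i, (lam i - nu i) * x i - K * θ = 2 * ((n : ℝ) - K)) :
    θ = 2 ∧ ψ = 0 := by
  have h1 : ∑ i, (lam i - nu i) * x i ≤ ∑ _i : Fin n, θ := by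
    apply Finset.sum_le_sum
    intro i _
    obtain ⟨ha, hb⟩ := abs_le.mp (hx i)
    have h2 := mul_nonneg (hlam i) (sub_nonneg.mpr hb)
    have h3 := mul_nonneg (hnu i) (by linarith : 0 ≤ 1 + x i)
    have h4 := hsum i
    nlinarith
  simp only [Finset.sum_const, Finset.card_univ, Fintype.card_fin, nsmul_eq_mul] at h1
  have h5 : 2 ≤ θ := by
    by_contra h
    push Not at h
    nlinarith [mul_pos (sub_pos.mpr hK) (sub_pos.mpr h)]
  constructor <;> linarith
end
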